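/- arXiv:0809.0454 — 4 statements merged into one kernel-verified Lean document; each statement's English description precedes it below -/
import Mathlib

section
/- Let w be a ℤ/2-edge-weighting of K_{3,3}. If at least one 4-cycle of K_{3,3} is odd, then exactly one of the following holds: (1) there is an edge e of K_{3,3} such that a 4-cycle is odd if and only if it contains e (a 4-pattern with including edge e); or (2) there is a set F of three pairwise vertex-disjoint edges of K_{3,3} such that a 4-cycle is odd if and only if it contains at most one edge of F (a 6-pattern with excluding set F). -/
open SimpleGraph

/-- The complete bipartite graph `K_{3,3}`. -/
def K33 : SimpleGraph (Fin 3 ⊕ Fin 3) := completeBipartiteGraph (Fin 3) (Fin 3)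

/-- The ℤ/2-weight of a closed walk: the sum of the weights of its edges. -/
def cycWeight (w : Sym2 (Fin 3 ⊕ Fin 3) → ZMod 2) {v : Fin 3 ⊕ Fin 3}
    (c : K33.Walk v v) : ZMod 2 :=
  (c.edges.map w).sum

/-- A 4-pattern: there is an (including) edge `e` of `K_{3,3}` such that a 4-cycle is odd
iff it contains `e`. -/
def Is4Pattern (w : Sym2 (Fin 3 ⊕ Fin 3) → ZMod 2) : Prop :=
  ∃ e ∈ K33.edgeSet, ∀ (v : Fin 3 ⊕ Fin 3) (c : K33.Walk v v),
    c.IsCycle → c.length = 4 → (cycWeight w c = 1 ↔ e ∈ c.edges)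

/-- A 6-pattern: there is a set `F` of three pairwise vertex-disjoint (excluding) edges of
`K_{3,3}` such that a 4-cycle is odd iff it contains at most one edge of `F`. -/
def Is6Pattern (w : Sym2 (Fin 3 ⊕ Fin 3) → ZMod 2) : Prop :=
  ∃ F : Finset (Sym2 (Fin 3 ⊕ Fin 3)), F.card = 3 ∧
    (∀ e ∈ F, e ∈ K33.edgeSet) ∧
    (∀ e ∈ F, ∀ f ∈ F, e ≠ f → ∀ x, ¬(x ∈ e ∧ x ∈ f)) ∧
    ∀ (v : Fin 3 ⊕ Fin 3) (c : K33.Walk v v), c.IsCycle → c.length = 4 →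
      (cycWeight w c = 1 ↔ (F.filter (· ∈ c.edges)).card ≤ 1)

/-- The 4-cycle of `K_{3,3}` through all vertices except `a_r` and `b_s`. -/
def cycleAvoiding (r s : Fin 3) : K33.Walk (Sum.inl (r + 1)) (Sum.inl (r + 1)) :=
  .cons (v := Sum.inr (s + 1)) (by simp [K33]) <|
  .cons (v := Sum.inl (r + 2)) (by simp [K33]) <|
  .cons (v := Sum.inr (s + 2)) (by simp [K33]) <|
  .cons (by simp [K33]) .nil

theorem edges_cycleAvoiding (r s : Fin 3) : (cycleAvoiding r s).edges =
    [s(Sum.inl (r + 1), Sum.inr (s + 1)), s(Sum.inr (s + 1), Sum.inl (r + 2)),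
      s(Sum.inl (r + 2), Sum.inr (s + 2)), s(Sum.inr (s + 2), Sum.inl (r + 1))] := rfl

theorem length_cycleAvoiding (r s : Fin 3) : (cycleAvoiding r s).length = 4 := rfl

theorem isCycle_cycleAvoiding (r s : Fin 3) : (cycleAvoiding r s).IsCycle := by
  rw [Walk.isCycle_def, Walk.isTrail_def]
  refine ⟨?_, nofun, ?_⟩
  · rw [edges_cycleAvoiding]
    revert r s
    decide
  · change [Sum.inr (s + 1), Sum.inl (r + 2), Sum.inr (s + 2), Sum.inl (r + 1)].Nodup
    revert r s
    decide

theorem mem_edges_cycleAvoiding (r s i j : Fin 3) :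
    s(Sum.inl i, Sum.inr j) ∈ (cycleAvoiding r s).edges ↔ i ≠ r ∧ j ≠ s := by
  rw [edges_cycleAvoiding]
  revert r s i j
  decide

theorem exists_perm_edges_cycleAvoiding {i k j l : Fin 3} (hik : i ≠ k) (hjl : j ≠ l) :
    ∃ r s, [s(Sum.inl i, Sum.inr j), s(Sum.inr j, Sum.inl k), s(Sum.inl k, Sum.inr l),
      s(Sum.inr l, Sum.inl i)].Perm (cycleAvoiding r s).edges := by
  simp only [edges_cycleAvoiding]
  revert i k j l
  decide

theorem exists_edges_perm_of_isCycle {v : Fin 3 ⊕ Fin 3} (c : K33.Walk v v) (hc : c.IsCycle)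
    (h4 : c.length = 4) : ∃ r s, c.edges.Perm (cycleAvoiding r s).edges := by
  have hnodup := hc.support_nodup
  obtain _ | ⟨h₁, _ | ⟨h₂, _ | ⟨h₃, _ | ⟨h₄, _ | ⟨h₅, p⟩⟩⟩⟩⟩ := c <;>
    simp only [Walk.length_cons, Walk.length_nil] at h4 <;> try omega
  rename_i x y z
  rcases v with i | i <;> rcases x with j | j <;> simp [K33] at h₁ <;>
    rcases y with k | k <;> simp [K33] at h₂ <;>
    rcases z with l | l <;> simp [K33] at h₃ <;>
    simp at hnodup
  · exact exists_perm_edges_cycleAvoiding (Ne.symm hnodup.2) hnodup.1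
  · obtain ⟨r, s, h⟩ := exists_perm_edges_cycleAvoiding hnodup.1 hnodup.2
    exact ⟨r, s, (List.perm_append_singleton _ _).symm.trans h⟩

theorem forall_fourCycle_iff (Q : Multiset (Sym2 (Fin 3 ⊕ Fin 3)) → Prop) :
    (∀ (v : Fin 3 ⊕ Fin 3) (c : K33.Walk v v), c.IsCycle → c.length = 4 → Q c.edges) ↔
      ∀ r s, Q (cycleAvoiding r s).edges := by
  refine ⟨fun h r s => h _ _ (isCycle_cycleAvoiding r s) (length_cycleAvoiding r s),
    fun h v c hc h4 => ?_⟩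
  obtain ⟨r, s, hp⟩ := exists_edges_perm_of_isCycle c hc h4
  rw [Multiset.coe_eq_coe.2 hp]
  exact h r s

theorem is4Pattern_iff (w : Sym2 (Fin 3 ⊕ Fin 3) → ZMod 2) : Is4Pattern w ↔
    ∃ a b, ∀ r s, cycWeight w (cycleAvoiding r s) = 1 ↔ a ≠ r ∧ b ≠ s := by
  have key (e : Sym2 (Fin 3 ⊕ Fin 3)) :=
    forall_fourCycle_iff fun m => ((m.map w).sum = 1 ↔ e ∈ m)
  simp only [Multiset.map_coe, Multiset.sum_coe, Multiset.mem_coe] at key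
  unfold Is4Pattern
  simp only [cycWeight, key]
  constructor
  · rintro ⟨e, he, h⟩
    induction e with | _ x y
    rcases x with a | b <;> rcases y with a' | b' <;> simp [K33] at he
    · exact ⟨a, b', fun r s => by rw [h, mem_edges_cycleAvoiding]⟩
    · exact ⟨a', b, fun r s => by rw [h, Sym2.eq_swap, mem_edges_cycleAvoiding]⟩
  · rintro ⟨a, b, h⟩
    exact ⟨s(Sum.inl a, Sum.inr b), by simp [K33], fun r s => by rw [h, mem_edges_cycleAvoiding]⟩

/-- The perfect matching of `K_{3,3}` with edges `a_i b_{σ i}`. -/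
def matching (σ : Equiv.Perm (Fin 3)) : Finset (Sym2 (Fin 3 ⊕ Fin 3)) :=
  Finset.univ.image fun i => s(Sum.inl i, Sum.inr (σ i))

theorem injective_matching_edge (σ : Fin 3 → Fin 3) :
    Function.Injective fun i => (s(Sum.inl i, Sum.inr (σ i)) : Sym2 (Fin 3 ⊕ Fin 3)) := by
  intro i k h
  simpa using And.left (by simpa using h)

theorem card_matching (σ : Equiv.Perm (Fin 3)) : (matching σ).card = 3 := by
  rw [matching, Finset.card_image_of_injective _ (injective_matching_edge σ)]
  rfl

theorem card_matching_filter_le_one_iff (σ : Equiv.Perm (Fin 3)) (r s : Fin 3) :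
    ((matching σ).filter (· ∈ (cycleAvoiding r s).edges)).card ≤ 1 ↔ σ r ≠ s := by
  rw [matching, Finset.filter_image, Finset.card_image_of_injective _ (injective_matching_edge σ)]
  simp only [mem_edges_cycleAvoiding]
  revert σ r s
  decide

theorem exists_eq_matching {F : Finset (Sym2 (Fin 3 ⊕ Fin 3))} (hcard : F.card = 3)
    (hF : ∀ e ∈ F, e ∈ K33.edgeSet)
    (hdisj : ∀ e ∈ F, ∀ f ∈ F, e ≠ f → ∀ x, ¬(x ∈ e ∧ x ∈ f)) : ∃ σ, F = matching σ := by
  have hform : ∀ e ∈ F, ∃ i j, e = s(Sum.inl i, Sum.inr j) := by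
    intro e he
    have he' := hF e he
    induction e with | _ x y
    rcases x with a | b <;> rcases y with a' | b' <;> simp [K33] at he'
    · exact ⟨a, b', rfl⟩
    · exact ⟨a', b, Sym2.eq_swap⟩
  choose! f g hfg using hform
  have hinj : Set.InjOn f F := by
    intro e he e' he' h
    by_contra hne
    refine hdisj e he e' he' hne (Sum.inl (f e)) ⟨?_, ?_⟩
    · exact Sym2.mem_iff_exists.2 ⟨_, hfg e he⟩
    · exact Sym2.mem_iff_exists.2 ⟨_, h ▸ hfg e' he'⟩
  have himage : F.image f = Finset.univ := by
    rw [← Finset.card_eq_iff_eq_univ, Finset.card_image_of_injOn hinj, hcard, Fintype.card_fin]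
  have hmem (i : Fin 3) : ∃ j, s(Sum.inl i, Sum.inr j) ∈ F := by
    obtain ⟨e, he, rfl⟩ := Finset.mem_image.1 (himage ▸ Finset.mem_univ i)
    exact ⟨g e, hfg e he ▸ he⟩
  choose τ hτ using hmem
  have hτinj : Function.Injective τ := by
    intro i k h
    by_contra hne
    exact hdisj _ (hτ i) _ (hτ k) (fun heq => hne (by simpa using And.left (by simpa using heq)))
      (Sum.inr (τ i)) ⟨Sym2.mem_mk_right _ _, h ▸ Sym2.mem_mk_right _ _⟩
  refine ⟨Equiv.ofBijective τ (Finite.injective_iff_bijective.1 hτinj),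
    (Finset.eq_of_subset_of_card_le ?_ ?_).symm⟩
  · intro e he
    obtain ⟨i, -, rfl⟩ := Finset.mem_image.1 he
    exact hτ i
  · rw [card_matching, hcard]

theorem is6Pattern_iff (w : Sym2 (Fin 3 ⊕ Fin 3) → ZMod 2) : Is6Pattern w ↔
    ∃ σ : Equiv.Perm (Fin 3), ∀ r s, cycWeight w (cycleAvoiding r s) = 1 ↔ σ r ≠ s := by
  have key (F : Finset (Sym2 (Fin 3 ⊕ Fin 3))) :=
    forall_fourCycle_iff fun m => ((m.map w).sum = 1 ↔ (F.filter (· ∈ m)).card ≤ 1)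
  simp only [Multiset.map_coe, Multiset.sum_coe, Multiset.mem_coe] at key
  unfold Is6Pattern
  simp only [cycWeight, key]
  constructor
  · rintro ⟨F, hcard, hF, hdisj, h⟩
    obtain ⟨σ, rfl⟩ := exists_eq_matching hcard hF hdisj
    exact ⟨σ, fun r s => by rw [h, card_matching_filter_le_one_iff]⟩
  · rintro ⟨σ, h⟩
    refine ⟨matching σ, card_matching σ, ?_, ?_,
      fun r s => by rw [h, card_matching_filter_le_one_iff]⟩
    · intro e he
      obtain ⟨i, -, rfl⟩ := Finset.mem_image.1 he
      simp [K33]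
    · intro e he f hf hne x
      obtain ⟨i, -, rfl⟩ := Finset.mem_image.1 he
      obtain ⟨k, -, rfl⟩ := Finset.mem_image.1 hf
      have hik : i ≠ k := fun h => hne (by rw [h])
      rcases x with x | x <;> simp only [Sym2.mem_iff, reduceCtorEq, Sum.inl.injEq, Sum.inr.injEq,
        or_false, false_or]
      · rintro ⟨rfl, h⟩
        exact hik h
      · rintro ⟨rfl, h⟩
        exact hik (σ.injective h)

/-- The 3 × 3 matrix over `ℤ/2` with vanishing row and column sums that extends a 2 × 2 matrix. -/
def evenExtension (x : Fin 2 → Fin 2 → ZMod 2) : Fin 3 → Fin 3 → ZMod 2 :=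
  ![![x 0 0, x 0 1, x 0 0 + x 0 1], ![x 1 0, x 1 1, x 1 0 + x 1 1],
    ![x 0 0 + x 1 0, x 0 1 + x 1 1, x 0 0 + x 0 1 + x 1 0 + x 1 1]]

theorem xor_pattern_evenExtension (x : Fin 2 → Fin 2 → ZMod 2)
    (h : ∃ r s, evenExtension x r s = 1) :
    Xor' (∃ a b, ∀ r s, evenExtension x r s = 1 ↔ a ≠ r ∧ b ≠ s)
      (∃ σ : Equiv.Perm (Fin 3), ∀ r s, evenExtension x r s = 1 ↔ σ r ≠ s) := by
  unfold Xor'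
  revert x
  decide

theorem cycWeight_cycleAvoiding (w : Sym2 (Fin 3 ⊕ Fin 3) → ZMod 2) (r s : Fin 3) :
    cycWeight w (cycleAvoiding r s) =
      w s(Sum.inl (r + 1), Sum.inr (s + 1)) + w s(Sum.inl (r + 2), Sum.inr (s + 1)) +
      w s(Sum.inl (r + 2), Sum.inr (s + 2)) + w s(Sum.inl (r + 1), Sum.inr (s + 2)) := by
  rw [cycWeight, edges_cycleAvoiding, Sym2.eq_swap (a := Sum.inr (s + 1)),
    Sym2.eq_swap (a := Sum.inr (s + 2))]
  simp [add_assoc]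

theorem cycWeight_eq_evenExtension (w : Sym2 (Fin 3 ⊕ Fin 3) → ZMod 2) (r s : Fin 3) :
    cycWeight w (cycleAvoiding r s) = evenExtension
      (fun i j => cycWeight w (cycleAvoiding i.castSucc j.castSucc)) r s := by
  simp only [evenExtension, cycWeight_cycleAvoiding]
  have h20 : (2 : Fin 3) + 1 = 0 := rfl
  have h21 : (2 : Fin 3) + 2 = 1 := rfl
  have h12 : (1 : Fin 3) + 2 = 0 := rfl
  have h11 : (1 : Fin 3) + 1 = 2 := rfl
  fin_cases r <;> fin_cases s <;> simp [h20, h21, h12, h11] <;>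
    rw [← CharTwo.add_eq_zero] <;> ring_nf <;> reduce_mod_char

/-- if some 4-cycle of `K_{3,3}` is odd, then exactly one of the following
holds: the weighting has a 4-pattern, or it has a 6-pattern. -/
theorem stmt1 (w : Sym2 (Fin 3 ⊕ Fin 3) → ZMod 2)
    (h : ∃ (v : Fin 3 ⊕ Fin 3) (c : K33.Walk v v),
      c.IsCycle ∧ c.length = 4 ∧ cycWeight w c = 1) :
    Xor' (Is4Pattern w) (Is6Pattern w) := by
  have hodd : ∃ r s, cycWeight w (cycleAvoiding r s) = 1 := by
    by_contra! hne
    obtain ⟨v, c, hc, h4, hw⟩ := h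
    exact (forall_fourCycle_iff fun m => (m.map w).sum ≠ 1).2 hne v c hc h4 hw
  rw [is4Pattern_iff, is6Pattern_iff]
  have key := xor_pattern_evenExtension fun i j =>
    cycWeight w (cycleAvoiding i.castSucc j.castSucc)
  simp only [← cycWeight_eq_evenExtension] at key
  exact key hodd
end

section
/- For every ℤ/2-edge-weighting of K_{3,3}, the number of odd 4-cycles of K_{3,3} is 0, 4, or 6. -/
open SimpleGraph

/-- Among the values of a `ℤ/2`-bilinear form on `(ℤ/2)² × (ℤ/2)²` with Gram matrix `!![x, y; z, t]`
at pairs of nonzero vectors, exactly `0`, `4` or `6` are equal to `1`. -/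
lemma card_bilinear_odd (x y z t : ZMod 2) :
    let odd (s : ZMod 2) : ℕ := if s = 1 then 1 else 0
    let n := odd x + odd y + odd (x + y) + (odd z + odd t + odd (z + t)) +
      (odd (x + z) + odd (y + t) + odd (x + y + z + t))
    n = 0 ∨ n = 4 ∨ n = 6 := by
  revert x y z t
  decide

lemma powersetCard_two_fin_three :
    Finset.powersetCard 2 (Finset.univ : Finset (Fin 3)) = {{0, 1}, {0, 2}, {1, 2}} := by
  decide

/-- The number of odd 4-cycles of `K_{3,3}` as a count of values of a bilinear form. -/
lemma card_odd_four_cycles (f : Fin 3 → Fin 3 → ZMod 2) :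
    let odd (s : ZMod 2) : ℕ := if s = 1 then 1 else 0
    let x := f 0 0 + f 0 1 + (f 1 0 + f 1 1)
    let y := f 0 0 + f 0 2 + (f 1 0 + f 1 2)
    let z := f 0 0 + f 0 1 + (f 2 0 + f 2 1)
    let t := f 0 0 + f 0 2 + (f 2 0 + f 2 2)
    (Finset.univ.filter fun p : Finset (Fin 3) × Finset (Fin 3) =>
        p.1.card = 2 ∧ p.2.card = 2 ∧ (∑ i ∈ p.1, ∑ j ∈ p.2, f i j) = 1).card =
      odd x + odd y + odd (x + y) + (odd z + odd t + odd (z + t)) +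
        (odd (x + z) + odd (y + t) + odd (x + y + z + t)) := by
  intro odd x y z t
  have hfilter : (Finset.univ.filter fun p : Finset (Fin 3) × Finset (Fin 3) =>
        p.1.card = 2 ∧ p.2.card = 2 ∧ (∑ i ∈ p.1, ∑ j ∈ p.2, f i j) = 1) =
      (Finset.powersetCard 2 Finset.univ ×ˢ Finset.powersetCard 2 Finset.univ).filter
        fun p => (∑ i ∈ p.1, ∑ j ∈ p.2, f i j) = 1 := by
    ext p
    simp [and_assoc]
  have h2 : (2 : ZMod 2) = 0 := rfl
  have hxy : x + y = f 0 1 + f 0 2 + (f 1 1 + f 1 2) := by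
    linear_combination (f 0 0 + f 1 0) * h2
  have hzt : z + t = f 0 1 + f 0 2 + (f 2 1 + f 2 2) := by
    linear_combination (f 0 0 + f 2 0) * h2
  have hxz : x + z = f 1 0 + f 1 1 + (f 2 0 + f 2 1) := by
    linear_combination (f 0 0 + f 0 1) * h2
  have hyt : y + t = f 1 0 + f 1 2 + (f 2 0 + f 2 2) := by
    linear_combination (f 0 0 + f 0 2) * h2
  have hxyzt : x + y + z + t = f 1 1 + f 1 2 + (f 2 1 + f 2 2) := by
    linear_combination (2 * f 0 0 + f 0 1 + f 0 2 + f 1 0 + f 2 0) * h2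
  have hpair {a b : Fin 3} (h : a ≠ b) (g : Fin 3 → ZMod 2) : ∑ i ∈ {a, b}, g i = g a + g b :=
    Finset.sum_pair h
  have htriple (g : Finset (Fin 3) → ℕ) :
      ∑ s ∈ {{0, 1}, {0, 2}, {1, 2}}, g s = g {0, 1} + g {0, 2} + g {1, 2} := by
    rw [Finset.sum_insert (by decide), Finset.sum_pair (by decide), add_assoc]
  rw [hfilter, Finset.card_filter, Finset.sum_product, powersetCard_two_fin_three,
    hxyzt, hxy, hzt, hxz, hyt]
  simp only [htriple, hpair (show (0 : Fin 3) ≠ 1 by decide),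
    hpair (show (0 : Fin 3) ≠ 2 by decide), hpair (show (1 : Fin 3) ≠ 2 by decide)]
  rfl

/-- for every ℤ/2-edge-weighting `w` of `K_{3,3}` (with parts indexed by
`Fin 3`, vertex `Sum.inl i` being `aᵢ` and `Sum.inr j` being `bⱼ`), the number of odd
4-cycles of `K_{3,3}` is `0`, `4`, or `6`.  A 4-cycle `a_i b_j a_k b_l` (`i ≠ k`, `j ≠ l`)
is parametrized by the pair of 2-element subsets `({i,k}, {j,l})` of `Fin 3`, and its
weight is the sum of `w` over the four edges joining `{a_i, a_k}` and `{b_j, b_l}`. -/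
theorem stmt2 (w : Sym2 (Fin 3 ⊕ Fin 3) → ZMod 2) :
    ((Finset.univ.filter fun p : Finset (Fin 3) × Finset (Fin 3) =>
        p.1.card = 2 ∧ p.2.card = 2 ∧
          (∑ i ∈ p.1, ∑ j ∈ p.2, w s(Sum.inl i, Sum.inr j)) = 1).card = 0) ∨
    ((Finset.univ.filter fun p : Finset (Fin 3) × Finset (Fin 3) =>
        p.1.card = 2 ∧ p.2.card = 2 ∧
          (∑ i ∈ p.1, ∑ j ∈ p.2, w s(Sum.inl i, Sum.inr j)) = 1).card = 4) ∨
    ((Finset.univ.filter fun p : Finset (Fin 3) × Finset (Fin 3) =>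
        p.1.card = 2 ∧ p.2.card = 2 ∧
          (∑ i ∈ p.1, ∑ j ∈ p.2, w s(Sum.inl i, Sum.inr j)) = 1).card = 6) := by
  rw [card_odd_four_cycles fun i j => w s(Sum.inl i, Sum.inr j)]
  exact card_bilinear_odd _ _ _ _
end

section
/- Suppose a ℤ/2-edge-weighting of K_{3,3} has a 4-pattern with including edge e, i.e., a 4-cycle of K_{3,3} is odd if and only if it contains e. Then for every cycle C of K_{3,3} (of any length), C is odd if and only if C contains the edge e. -/
open SimpleGraph

lemma K33_adj_inl_inr (i j : Fin 3) : K33.Adj (Sum.inl i) (Sum.inr j) := by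
  simp [K33]

/-- The closed walk `a_i b_j a_k b_l a_i` of `K_{3,3}`. -/
def fourWalk (i j k l : Fin 3) : K33.Walk (Sum.inl i) (Sum.inl i) :=
  .cons (K33_adj_inl_inr i j) (.cons (K33_adj_inl_inr k j).symm
    (.cons (K33_adj_inl_inr k l) (.cons (K33_adj_inl_inr i l).symm .nil)))

lemma fourWalk_isCycle {i j k l : Fin 3} (hik : i ≠ k) (hjl : j ≠ l) :
    (fourWalk i j k l).IsCycle := by
  simp [fourWalk, Walk.cons_isCycle_iff, Walk.cons_isPath_iff, hik, hik.symm, hjl]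

lemma fourWalk_edges (i j k l : Fin 3) :
    (fourWalk i j k l).edges = [s(Sum.inl i, Sum.inr j), s(Sum.inl k, Sum.inr j),
      s(Sum.inl k, Sum.inr l), s(Sum.inl i, Sum.inr l)] := by
  simp [fourWalk, Sym2.eq_swap]

lemma sum_map_edges_of_coboundary {V : Type*} {G : SimpleGraph V} {f : Sym2 V → ZMod 2}
    {p : V → ZMod 2} (hf : ∀ u v, G.Adj u v → f s(u, v) = p u + p v) {u v : V}
    (c : G.Walk u v) : (c.edges.map f).sum = p u + p v := by
  induction c with
  | nil => simp [CharTwo.add_self_eq_zero]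
  | cons h c ih =>
    rw [Walk.edges_cons, List.map_cons, List.sum_cons, ih, hf _ _ h]
    rw [add_assoc, CharTwo.add_cancel_left]

/-- A weighting vanishing on all 4-cycles of `K_{3,3}` vanishes on all closed walks. -/
lemma cycWeight_eq_zero {f : Sym2 (Fin 3 ⊕ Fin 3) → ZMod 2}
    (hf : ∀ i j k l : Fin 3, i ≠ k → j ≠ l → cycWeight f (fourWalk i j k l) = 0)
    {v : Fin 3 ⊕ Fin 3} (c : K33.Walk v v) : cycWeight f c = 0 := by
  have f_eq (i j : Fin 3) : f s(Sum.inl i, Sum.inr j) =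
      f s(Sum.inl i, Sum.inr 0) + (f s(Sum.inl 0, Sum.inr j) + f s(Sum.inl 0, Sum.inr 0)) := by
    by_cases hi : i = 0
    · subst hi
      grind
    by_cases hj : j = 0
    · subst hj
      grind
    have h := hf i j 0 0 hi hj
    simp only [cycWeight, fourWalk_edges, List.map_cons, List.map_nil, List.sum_cons,
      List.sum_nil] at h
    grind
  have key := sum_map_edges_of_coboundary (G := K33) (f := f)
    (p := Sum.elim (fun i => f s(Sum.inl i, Sum.inr 0))
      (fun j => f s(Sum.inl 0, Sum.inr j) + f s(Sum.inl 0, Sum.inr 0))) (by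
      rintro (i | i) (j | j) h
      · simp [K33] at h
      · exact f_eq i j
      · rw [Sym2.eq_swap, f_eq j i]
        exact add_comm _ _
      · simp [K33] at h) c
  rw [cycWeight, key, CharTwo.add_self_eq_zero]

lemma List.Nodup.sum_map_add_single {α : Type*} [DecidableEq α] {L : List α} (hL : L.Nodup)
    (w : α → ZMod 2) (e : α) :
    (L.map (w + Pi.single e 1)).sum = (L.map w).sum + if e ∈ L then 1 else 0 := by
  induction L with
  | nil => simp
  | cons a L ih =>
    rw [List.nodup_cons] at hL
    simp only [List.map_cons, List.sum_cons, ih hL.2, Pi.add_apply, Pi.single_apply,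
      List.mem_cons]
    grind

lemma cycWeight_add_single_eq_zero_iff (w : Sym2 (Fin 3 ⊕ Fin 3) → ZMod 2)
    (e : Sym2 (Fin 3 ⊕ Fin 3)) {v : Fin 3 ⊕ Fin 3} {c : K33.Walk v v} (hc : c.IsCycle) :
    cycWeight (w + Pi.single e 1) c = 0 ↔ (cycWeight w c = 1 ↔ e ∈ c.edges) := by
  have parity (x : ZMod 2) : (x + 1 = 0 ↔ x = 1) ∧ (x = 0 ↔ x ≠ 1) := by
    revert x
    decide
  rw [cycWeight, hc.edges_nodup.sum_map_add_single, cycWeight]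
  split_ifs with h <;> simp [h, parity]

/-- if a ℤ/2-edge-weighting of `K_{3,3}` has a 4-pattern with including edge
`e` (a 4-cycle is odd iff it contains `e`), then every cycle of `K_{3,3}` (of any length)
is odd iff it contains `e`. -/
theorem stmt3 (w : Sym2 (Fin 3 ⊕ Fin 3) → ZMod 2) (e : Sym2 (Fin 3 ⊕ Fin 3))
    (he : e ∈ K33.edgeSet)
    (h4 : ∀ (v : Fin 3 ⊕ Fin 3) (c : K33.Walk v v), c.IsCycle → c.length = 4 →
      (cycWeight w c = 1 ↔ e ∈ c.edges)) :
    ∀ (v : Fin 3 ⊕ Fin 3) (c : K33.Walk v v), c.IsCycle →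
      (cycWeight w c = 1 ↔ e ∈ c.edges) := by
  intro v c hc
  rw [← cycWeight_add_single_eq_zero_iff w e hc]
  refine cycWeight_eq_zero (fun i j k l hik hjl => ?_) c
  have hcycle := fourWalk_isCycle hik hjl
  exact (cycWeight_add_single_eq_zero_iff w e hcycle).2 (h4 _ _ hcycle rfl)
end

section
/- Let G be the graph obtained from the complete bipartite graph K_{4,4} by deleting one edge, and let w be any ℤ/2-edge-weighting of G. Then either there exist two vertex-disjoint cycles of G that are both odd, or there exists a vertex v of G such that every odd cycle of G passes through v. -/
open SimpleGraph

/-- The complete bipartite graph `K_{4,4}`. -/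
def K44 : SimpleGraph (Fin 4 ⊕ Fin 4) := completeBipartiteGraph (Fin 4) (Fin 4)

/-- The weight of the 4-cycle on rows `i`, `k` and columns `j`, `l` of a bipartite weighting. -/
def squareWeight (m : Fin 4 → Fin 4 → ZMod 2) (i k j l : Fin 4) : ZMod 2 :=
  m i j + m k j + m k l + m i l

/-- Two vertex-disjoint odd 4-cycles avoiding the edge `(0, 0)`. -/
def HasDisjointOddSquares (m : Fin 4 → Fin 4 → ZMod 2) : Prop :=
  ∃ i, i ≠ 0 ∧ ∃ k, (k ≠ 0 ∧ k ≠ i) ∧ ∃ l, (l ≠ 0 ∧ l ≠ i ∧ l ≠ k) ∧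
    ∃ j, j ≠ 0 ∧ squareWeight m k l 0 j = 1 ∧
      ∃ p, (p ≠ 0 ∧ p ≠ j) ∧ ∃ q, (q ≠ 0 ∧ q ≠ j ∧ q ≠ p) ∧ squareWeight m 0 i p q = 1

/-- Away from a single vertex and the edge `(0, 0)`, all 4-cycles through a row `r` and a column
`c` are even. -/
def BalancedAwayFromVertex (m : Fin 4 → Fin 4 → ZMod 2) : Prop :=
  ∃ x : Fin 4 ⊕ Fin 4, ∃ r, r ≠ 0 ∧ ∃ c, c ≠ 0 ∧ ∀ i, Sum.inl i ≠ x → ∀ j, Sum.inr j ≠ x →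
    (i ≠ 0 ∨ j ≠ 0) → squareWeight m r i c j = 0

instance (m : Fin 4 → Fin 4 → ZMod 2) : Decidable (HasDisjointOddSquares m) := by
  unfold HasDisjointOddSquares; infer_instance

instance (m : Fin 4 → Fin 4 → ZMod 2) : Decidable (BalancedAwayFromVertex m) := by
  unfold BalancedAwayFromVertex; infer_instance

set_option maxRecDepth 100000 in
theorem dichotomy_of_normalized : ∀ a b c d e f g h : ZMod 2,
    HasDisjointOddSquares ![![0, 0, a, b], ![0, 0, 0, 0], ![c, 0, d, e], ![f, 0, g, h]] ∨
    BalancedAwayFromVertex ![![0, 0, a, b], ![0, 0, 0, 0], ![c, 0, d, e], ![f, 0, g, h]] := by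
  decide +kernel

theorem squareWeight_congr {m n : Fin 4 → Fin 4 → ZMod 2} (f g : Fin 4 → ZMod 2)
    (h : ∀ i j, i ≠ 0 ∨ j ≠ 0 → n i j = m i j + f i + g j) {i k j l : Fin 4}
    (hij : i ≠ 0 ∨ j ≠ 0) (hkj : k ≠ 0 ∨ j ≠ 0) (hkl : k ≠ 0 ∨ l ≠ 0) (hil : i ≠ 0 ∨ l ≠ 0) :
    squareWeight n i k j l = squareWeight m i k j l := by
  unfold squareWeight
  rw [h i j hij, h k j hkj, h k l hkl, h i l hil]
  linear_combination CharTwo.add_self_eq_zero (f i) + CharTwo.add_self_eq_zero (f k) +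
    CharTwo.add_self_eq_zero (g j) + CharTwo.add_self_eq_zero (g l)

theorem hasDisjointOddSquares_or_balancedAwayFromVertex (m : Fin 4 → Fin 4 → ZMod 2) :
    HasDisjointOddSquares m ∨ BalancedAwayFromVertex m := by
  have hself : ∀ y : ZMod 2, y + y = 0 := CharTwo.add_self_eq_zero
  let d : Fin 4 → Fin 4 → ZMod 2 := fun i j => m i j + (m i 1 + m 1 1) + m 1 j
  let n : Fin 4 → Fin 4 → ZMod 2 :=
    ![![0, 0, d 0 2, d 0 3], ![0, 0, 0, 0], ![d 2 0, 0, d 2 2, d 2 3], ![d 3 0, 0, d 3 2, d 3 3]]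
  have hn : ∀ i j, i ≠ 0 ∨ j ≠ 0 → n i j = m i j + (m i 1 + m 1 1) + m 1 j := by
    have hrow : ∀ j, d 1 j = 0 := fun j => by
      linear_combination hself (m 1 j) + hself (m 1 1)
    have hcol : ∀ i, d i 1 = 0 := fun i => by
      linear_combination hself (m i 1) + hself (m 1 1)
    intro i j hij
    change n i j = d i j
    fin_cases i <;> fin_cases j <;>
      first | exact (hrow _).symm | exact (hcol _).symm | rfl | simp at hij
  rcases dichotomy_of_normalized (d 0 2) (d 0 3) (d 2 0) (d 2 2) (d 2 3) (d 3 0) (d 3 2) (d 3 3)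
    with h | h
  · left
    obtain ⟨i, hi, k, hk, l, hl, j, hj, h1, p, hp, q, hq, h2⟩ := h
    refine ⟨i, hi, k, hk, l, hl, j, hj, ?_, p, hp, q, hq, ?_⟩
    · rw [← h1]
      exact (squareWeight_congr _ _ hn (.inl hk.1) (.inl hl.1) (.inl hl.1) (.inl hk.1)).symm
    · rw [← h2]
      exact (squareWeight_congr _ _ hn (.inr hp.1) (.inr hp.1) (.inr hq.1) (.inr hq.1)).symm
  · right
    obtain ⟨x, r, hr, c, hc, h⟩ := h
    refine ⟨x, r, hr, c, hc, fun i hi j hj hij => ?_⟩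
    rw [← h i hi j hj hij]
    exact (squareWeight_congr _ _ hn (.inl hr) (.inr hc) hij (.inl hr)).symm

/-- A weighting that is the coboundary of `p` on all edges avoiding `x` telescopes along walks
avoiding `x`. -/
theorem SimpleGraph.Walk.sum_map_edges_eq_of_coboundary {V : Type*} {G : SimpleGraph V}
    {w : Sym2 V → ZMod 2} {x : V} {p : V → ZMod 2}
    (h : ∀ a b, G.Adj a b → a ≠ x → b ≠ x → w s(a, b) = p a + p b) {u v : V} (c : G.Walk u v)
    (hx : x ∉ c.support) : (c.edges.map w).sum = p u + p v := by
  induction c with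
  | nil => simp [CharTwo.add_self_eq_zero]
  | @cons u v t huv c ih =>
    rw [Walk.support_cons, List.mem_cons, not_or] at hx
    have hv : v ≠ x := fun hv => hx.2 (hv ▸ c.start_mem_support)
    rw [Walk.edges_cons, List.map_cons, List.sum_cons, ih hx.2, h u v huv (Ne.symm hx.1) hv]
    linear_combination CharTwo.add_self_eq_zero (p v)

theorem SimpleGraph.exists_isCycle_of_square {V : Type*} {G : SimpleGraph V} {a b c d : V}
    (hab : G.Adj a b) (hbc : G.Adj b c) (hcd : G.Adj c d) (hda : G.Adj d a)
    (hac : a ≠ c) (hbd : b ≠ d) :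
    ∃ C : G.Walk a a, C.IsCycle ∧ C.edges = [s(a, b), s(b, c), s(c, d), s(d, a)] ∧
      C.support = [a, b, c, d, a] := by
  refine ⟨.cons hab (.cons hbc (.cons hcd (.cons hda .nil))), ?_, rfl, rfl⟩
  have := hab.ne; have := hbc.ne; have := hcd.ne; have := hda.ne
  rw [Walk.cons_isCycle_iff]
  simp only [Walk.isPath_def, Walk.support_cons, Walk.support_nil, Walk.edges_cons,
    Walk.edges_nil, List.nodup_cons, List.mem_cons, Sym2.eq_iff]
  grind

theorem exists_isCycle_deleteEdges_K44 {a b : Fin 4} (w : Sym2 (Fin 4 ⊕ Fin 4) → ZMod 2)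
    {i k j l : Fin 4} (hik : i ≠ k) (hjl : j ≠ l)
    (h : (i ≠ a ∧ k ≠ a) ∨ (j ≠ b ∧ l ≠ b)) :
    ∃ C : (K44.deleteEdges {s(.inl a, .inr b)}).Walk (.inl i) (.inl i), C.IsCycle ∧
      (C.edges.map w).sum = w s(.inl i, .inr j) + w s(.inl k, .inr j) + w s(.inl k, .inr l) +
        w s(.inl i, .inr l) ∧
      C.support = [.inl i, .inr j, .inl k, .inr l, .inl i] := by
  have hadj : ∀ i j : Fin 4, i ≠ a ∨ j ≠ b →
      (K44.deleteEdges {s(.inl a, .inr b)}).Adj (.inl i) (.inr j) := by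
    intro i j hij
    simp [K44, deleteEdges_adj]
    tauto
  obtain ⟨C, hC, he, hs⟩ := exists_isCycle_of_square (hadj i j (by tauto))
    (hadj k j (by tauto)).symm (hadj k l (by tauto)) (hadj i l (by tauto)).symm
    (by simpa using hik) (by simpa using hjl)
  refine ⟨C, hC, ?_, hs⟩
  rw [he, Sym2.eq_swap (a := Sum.inr j), Sym2.eq_swap (a := Sum.inr l)]
  simp [add_assoc]

/-- let `G` be obtained from `K_{4,4}` by deleting one edge `e`, and let `w`
be any ℤ/2-edge-weighting of `G`.  Then either `G` has two vertex-disjoint odd cycles, or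
there is a vertex `x` through which every odd cycle of `G` passes. -/
theorem stmt4 (e : Sym2 (Fin 4 ⊕ Fin 4)) (he : e ∈ K44.edgeSet)
    (w : Sym2 (Fin 4 ⊕ Fin 4) → ZMod 2) :
    (∃ (u v : Fin 4 ⊕ Fin 4) (c1 : (K44.deleteEdges {e}).Walk u u)
        (c2 : (K44.deleteEdges {e}).Walk v v),
      c1.IsCycle ∧ c2.IsCycle ∧
      (c1.edges.map w).sum = 1 ∧ (c2.edges.map w).sum = 1 ∧
      ∀ x, ¬(x ∈ c1.support ∧ x ∈ c2.support)) ∨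
    (∃ x : Fin 4 ⊕ Fin 4, ∀ (v : Fin 4 ⊕ Fin 4) (c : (K44.deleteEdges {e}).Walk v v),
      c.IsCycle → (c.edges.map w).sum = 1 → x ∈ c.support) := by
  obtain ⟨a, b, rfl⟩ : ∃ a b : Fin 4, e = s(.inl a, .inr b) := by
    induction e using Sym2.ind with
    | _ u v =>
      rcases u with a | b <;> rcases v with a' | b'
      · simp [K44] at he
      · exact ⟨a, b', rfl⟩
      · exact ⟨a', b, Sym2.eq_swap⟩
      · simp [K44] at he
  obtain ⟨σ, rfl⟩ : ∃ σ : Equiv.Perm (Fin 4), σ 0 = a := ⟨Equiv.swap 0 a, by simp⟩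
  obtain ⟨τ, rfl⟩ : ∃ τ : Equiv.Perm (Fin 4), τ 0 = b := ⟨Equiv.swap 0 b, by simp⟩
  rcases hasDisjointOddSquares_or_balancedAwayFromVertex
    (fun i j => w s(.inl (σ i), .inr (τ j))) with h | h
  · left
    obtain ⟨i, hi, k, hk, l, hl, j, hj, h1, p, hp, q, hq, h2⟩ := h
    obtain ⟨C, hC, hCw, hCs⟩ := exists_isCycle_deleteEdges_K44 (a := σ 0) (b := τ 0) w
      (i := σ k) (k := σ l) (j := τ 0) (l := τ j) (by simpa using hl.2.2.symm)
      (by simpa using hj.symm) (.inl (by simp [hk.1, hl.1]))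
    obtain ⟨D, hD, hDw, hDs⟩ := exists_isCycle_deleteEdges_K44 (a := σ 0) (b := τ 0) w
      (i := σ 0) (k := σ i) (j := τ p) (l := τ q) (by simpa using hi.symm)
      (by simpa using hq.2.2.symm) (.inr (by simp [hp.1, hq.1]))
    refine ⟨_, _, C, D, hC, hD, hCw.trans h1, hDw.trans h2, ?_⟩
    rw [hCs, hDs]
    rintro (y | y) <;> simp only [List.mem_cons, Sum.inl.injEq, Sum.inr.injEq, reduceCtorEq,
      List.not_mem_nil, or_false, false_or] <;> grind [σ.injective.eq_iff, τ.injective.eq_iff]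
  · right
    obtain ⟨x, r, -, c, -, h⟩ := h
    let m : Fin 4 → Fin 4 → ZMod 2 := fun i j => w s(.inl i, .inr j)
    let P : Fin 4 ⊕ Fin 4 → ZMod 2 :=
      Sum.elim (fun i => m i (τ c) + m (σ r) (τ c)) (fun j => m (σ r) j)
    have hP : ∀ i j : Fin 4, i ≠ σ 0 ∨ j ≠ τ 0 → Sum.inl i ≠ x.map σ τ → Sum.inr j ≠ x.map σ τ →
        w s(.inl i, .inr j) = P (.inl i) + P (.inr j) := by
      intro i j hij hi hj
      obtain ⟨i, rfl⟩ := σ.surjective i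
      obtain ⟨j, rfl⟩ := τ.surjective j
      have key := h i (fun h => hi (by rw [← h]; rfl)) j (fun h => hj (by rw [← h]; rfl))
        (by simpa using hij)
      simp only [squareWeight] at key
      rw [← CharTwo.add_eq_zero, ← key]
      simp only [P, m, Sum.elim_inl, Sum.elim_inr]
      ring
    refine ⟨x.map σ τ, fun v C _ hodd => ?_⟩
    by_contra hx
    have hzero := C.sum_map_edges_eq_of_coboundary (w := w) (p := P) ?_ hx
    · rw [hodd, CharTwo.add_self_eq_zero] at hzero
      exact one_ne_zero hzero
    · rintro (i | j) (i' | j') hadj h1 h2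
      · simp [K44] at hadj
      · refine hP i j' ?_ h1 h2
        simp [K44] at hadj
        tauto
      · rw [Sym2.eq_swap, add_comm]
        refine hP i' j ?_ h2 h1
        simp [K44] at hadj
        tauto
      · simp [K44] at hadj
end
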